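/- Let x be a random vector in ℝ^d with finite fourth moments and H := E[x xᵀ], and suppose there is R > 0 with E[‖x‖² x xᵀ] ⪯ R² H. Let σ ≥ 0, 0 < η < 1/R², N ≥ 1, and define C₀ := 0 and C_{t+1} := E[(I − η x xᵀ) C_t (I − η x xᵀ)] + η² σ² H for t = 0,…,N−1. Then C_N ⪯ (η σ² / (1 − η R²)) · (I − (I − ηH)^N). -/

import Mathlib

open MeasureTheory Matrix

/-- Entrywise expectation of a matrix-valued random variable. -/
noncomputable def expMatrix {Ω : Type*} [MeasurableSpace Ω] {d : ℕ}
    (μ : Measure Ω) (f : Ω → Matrix (Fin d) (Fin d) ℝ) : Matrix (Fin d) (Fin d) ℝ :=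
  Matrix.of fun i j => ∫ ω, f ω i j ∂μ


/-- Entrywise integrability. -/
def GoodM {Ω : Type*} [MeasurableSpace Ω] {d : ℕ}
    (μ : Measure Ω) (f : Ω → Matrix (Fin d) (Fin d) ℝ) : Prop :=
  ∀ i j, Integrable (fun ω => f ω i j) μ

section aux
variable {Ω : Type*} [MeasurableSpace Ω] {d : ℕ} {μ : Measure Ω}
  {f g : Ω → Matrix (Fin d) (Fin d) ℝ}

theorem GoodM.add (hf : GoodM μ f) (hg : GoodM μ g) : GoodM μ (fun ω => f ω + g ω) :=
  fun i j => (hf i j).add (hg i j)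

theorem GoodM.sub (hf : GoodM μ f) (hg : GoodM μ g) : GoodM μ (fun ω => f ω - g ω) :=
  fun i j => (hf i j).sub (hg i j)

theorem GoodM.smul (c : ℝ) (hf : GoodM μ f) : GoodM μ (fun ω => c • f ω) :=
  fun i j => (hf i j).const_mul c

theorem GoodM.const [IsProbabilityMeasure μ] (A : Matrix (Fin d) (Fin d) ℝ) :
    GoodM μ (fun _ => A) :=
  fun _ _ => integrable_const _

theorem GoodM.mul_left (A : Matrix (Fin d) (Fin d) ℝ) (hf : GoodM μ f) :
    GoodM μ (fun ω => A * f ω) := by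
  intro i j
  simp only [Matrix.mul_apply]
  exact integrable_finsetSum _ fun k _ => (hf k j).const_mul _

theorem GoodM.mul_right (A : Matrix (Fin d) (Fin d) ℝ) (hf : GoodM μ f) :
    GoodM μ (fun ω => f ω * A) := by
  intro i j
  simp only [Matrix.mul_apply]
  exact integrable_finsetSum _ fun k _ => (hf i k).mul_const _

theorem expM_add (hf : GoodM μ f) (hg : GoodM μ g) :
    expMatrix μ (fun ω => f ω + g ω) = expMatrix μ f + expMatrix μ g := by
  ext i j; exact integral_add (hf i j) (hg i j)

theorem expM_sub (hf : GoodM μ f) (hg : GoodM μ g) :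
    expMatrix μ (fun ω => f ω - g ω) = expMatrix μ f - expMatrix μ g := by
  ext i j; exact integral_sub (hf i j) (hg i j)

theorem expM_smul (c : ℝ) :
    expMatrix μ (fun ω => c • f ω) = c • expMatrix μ f := by
  ext i j; exact integral_const_mul c _

theorem expM_const [IsProbabilityMeasure μ] (A : Matrix (Fin d) (Fin d) ℝ) :
    expMatrix μ (fun _ => A) = A := by
  ext i j; simp [expMatrix]

theorem expM_mul_left (A : Matrix (Fin d) (Fin d) ℝ) (hf : GoodM μ f) :
    expMatrix μ (fun ω => A * f ω) = A * expMatrix μ f := by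
  ext i j
  simp only [expMatrix, Matrix.mul_apply, Matrix.of_apply]
  rw [integral_finsetSum _ fun k _ => (hf k j).const_mul _]
  simp only [integral_const_mul]

theorem expM_mul_right (A : Matrix (Fin d) (Fin d) ℝ) (hf : GoodM μ f) :
    expMatrix μ (fun ω => f ω * A) = expMatrix μ f * A := by
  ext i j
  simp only [expMatrix, Matrix.mul_apply, Matrix.of_apply]
  rw [integral_finsetSum _ fun k _ => (hf i k).mul_const _]
  simp only [integral_mul_const]

theorem expM_psd (hf : GoodM μ f) (hp : ∀ ω, (f ω).PosSemidef) :
    (expMatrix μ f).PosSemidef := by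
  refine Matrix.PosSemidef.of_dotProduct_mulVec_nonneg ?_ ?_
  · ext i j
    simp only [expMatrix, Matrix.conjTranspose_apply, Matrix.of_apply, star_trivial]
    congr 1; ext ω
    simpa using (hp ω).1.apply i j
  · intro v
    have : star v ⬝ᵥ (expMatrix μ f *ᵥ v) = ∫ ω, star v ⬝ᵥ (f ω *ᵥ v) ∂μ := by
      simp only [expMatrix, dotProduct, mulVec, Matrix.of_apply]
      rw [integral_finsetSum]
      · refine Finset.sum_congr rfl fun i _ => ?_
        rw [integral_const_mul, integral_finsetSum]
        · simp only [integral_mul_const]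
        · exact fun k _ => (hf i k).mul_const _
      · exact fun i _ => (integrable_finsetSum _ fun k _ => (hf i k).mul_const _).const_mul _
    rw [this]
    exact integral_nonneg fun ω => (hp ω).dotProduct_mulVec_nonneg v

theorem abs_mul_le_sumsq (y : Fin d → ℝ) (i j : Fin d) : |y i * y j| ≤ ∑ k, y k ^ 2 := by
  have h1 : y i ^ 2 ≤ ∑ k, y k ^ 2 :=
    Finset.single_le_sum (f := fun k => y k ^ 2) (fun k _ => sq_nonneg _) (Finset.mem_univ i)
  have h2 : y j ^ 2 ≤ ∑ k, y k ^ 2 :=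
    Finset.single_le_sum (f := fun k => y k ^ 2) (fun k _ => sq_nonneg _) (Finset.mem_univ j)
  rw [abs_le]
  constructor <;> nlinarith [sq_nonneg (y i + y j), sq_nonneg (y i - y j)]

theorem good_X [IsProbabilityMeasure μ] (x : Ω → Fin d → ℝ) (hmeas : Measurable x)
    (hx4 : Integrable (fun ω => (∑ i, x ω i ^ 2) ^ 2) μ) :
    GoodM μ (fun ω => vecMulVec (x ω) (x ω)) := by
  intro i j
  simp only [vecMulVec_apply]
  have hm : ∀ k, Measurable fun ω => x ω k := fun k => (measurable_pi_apply k).comp hmeas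
  refine Integrable.mono' (hx4.add (integrable_const (1 : ℝ)))
    ((hm i).mul (hm j)).aestronglyMeasurable (Filter.Eventually.of_forall fun ω => ?_)
  have := abs_mul_le_sumsq (x ω) i j
  simp only [Real.norm_eq_abs, Pi.add_apply]
  nlinarith [sq_nonneg (∑ k, x ω k ^ 2 - 1)]

theorem good_XMX (x : Ω → Fin d → ℝ) (hmeas : Measurable x)
    (hx4 : Integrable (fun ω => (∑ i, x ω i ^ 2) ^ 2) μ) (M : Matrix (Fin d) (Fin d) ℝ) :
    GoodM μ (fun ω => vecMulVec (x ω) (x ω) * M * vecMulVec (x ω) (x ω)) := by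
  intro i j
  have hm : ∀ k, Measurable fun ω => x ω k := fun k => (measurable_pi_apply k).comp hmeas
  simp only [Matrix.mul_apply, vecMulVec_apply, Finset.sum_mul]
  refine integrable_finsetSum _ fun k _ => integrable_finsetSum _ fun l _ => ?_
  have : Integrable (fun ω => (x ω i * x ω l) * (x ω k * x ω j)) μ := by
    refine Integrable.mono' hx4
      (((hm i).mul (hm l)).mul ((hm k).mul (hm j))).aestronglyMeasurable
      (Filter.Eventually.of_forall fun ω => ?_)
    rw [Real.norm_eq_abs, abs_mul, sq]
    exact mul_le_mul (abs_mul_le_sumsq _ _ _) (abs_mul_le_sumsq _ _ _) (abs_nonneg _)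
      ((abs_nonneg _).trans (abs_mul_le_sumsq (x ω) i l))
  refine (this.const_mul (M l k)).congr (Filter.Eventually.of_forall fun ω => ?_)
  simp only []
  ring

theorem XX_eq (y : Fin d → ℝ) :
    (∑ k, y k ^ 2) • vecMulVec y y = vecMulVec y y * vecMulVec y y := by
  ext i j
  simp only [Matrix.smul_apply, Matrix.mul_apply, vecMulVec_apply, smul_eq_mul, Finset.sum_mul]
  exact Finset.sum_congr rfl fun k _ => by ring

theorem X_psd (y : Fin d → ℝ) : (vecMulVec y y).PosSemidef := by
  simpa using Matrix.posSemidef_vecMulVec_self_star y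

theorem psd_conj {M B : Matrix (Fin d) (Fin d) ℝ} (hM : M.PosSemidef) (hB : B.IsHermitian) :
    (B * M * B).PosSemidef := by
  have := hM.mul_mul_conjTranspose_same B
  rwa [hB.eq] at this

end aux

/-- For the single-task variance-iterate recursion
`C₀ = 0`, `C_{t+1} = E[(I − η x xᵀ) C_t (I − η x xᵀ)] + η² σ² H`, with
`E[‖x‖² x xᵀ] ⪯ R² H` and `0 < η < 1/R²`:
`C_N ⪯ (η σ²/(1 − η R²)) (I − (I − ηH)^N)`. -/
theorem single_task_variance_upper {d : ℕ} {Ω : Type*} [MeasurableSpace Ω]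
    (μ : Measure Ω) [IsProbabilityMeasure μ]
    (x : Ω → Fin d → ℝ) (hmeas : Measurable x)
    (hx4 : Integrable (fun ω => (∑ i, x ω i ^ 2) ^ 2) μ)
    (H : Matrix (Fin d) (Fin d) ℝ)
    (hH : H = expMatrix μ fun ω => vecMulVec (x ω) (x ω))
    (R : ℝ) (hR : 0 < R)
    (hRH : ((R ^ 2) • H
      - expMatrix μ fun ω => (∑ k, x ω k ^ 2) • vecMulVec (x ω) (x ω)).PosSemidef)
    (σ η : ℝ) (hσ : 0 ≤ σ) (hη0 : 0 < η) (hη1 : η < 1 / R ^ 2)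
    (N : ℕ) (hN : 1 ≤ N)
    (C : ℕ → Matrix (Fin d) (Fin d) ℝ) (hC0 : C 0 = 0)
    (hCrec : ∀ t < N,
      C (t + 1) =
        expMatrix μ (fun ω =>
          (1 - η • vecMulVec (x ω) (x ω)) * C t * (1 - η • vecMulVec (x ω) (x ω)))
        + (η ^ 2 * σ ^ 2) • H) :
    ((η * σ ^ 2 / (1 - η * R ^ 2)) • (1 - (1 - η • H) ^ N) - C N).PosSemidef := by
  set X : Ω → Matrix (Fin d) (Fin d) ℝ := fun ω => vecMulVec (x ω) (x ω) with hX
  have gX : GoodM μ X := good_X x hmeas hx4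
  have gXMX : ∀ M, GoodM μ (fun ω => X ω * M * X ω) := good_XMX x hmeas hx4
  have gXX : GoodM μ (fun ω => X ω * X ω) := by simpa using gXMX 1
  have pX : ∀ ω, (X ω).PosSemidef := fun ω => X_psd _
  have pH : H.PosSemidef := by rw [hH]; exact expM_psd gX pX
  simp only [XX_eq] at hRH
  change ((R ^ 2) • H - expMatrix μ fun ω => X ω * X ω).PosSemidef at hRH
  -- the second moment operator
  set S := expMatrix μ fun ω => X ω * X ω with hS
  have hηR : 0 < 1 - η * R ^ 2 := by
    have : 0 < R ^ 2 := by positivity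
    rw [lt_div_iff₀ this] at hη1
    linarith
  -- H² ⪯ R² H
  have hHS : (S - H * H).PosSemidef := by
    have e : S - H * H = expMatrix μ (fun ω => (X ω - H) * 1 * (X ω - H)) := by
      have : (fun ω => (X ω - H) * 1 * (X ω - H))
          = fun ω => X ω * X ω - H * X ω - X ω * H + H * H := by
        ext1 ω; noncomm_ring
      rw [this, expM_add ((gXX.sub (gX.mul_left H)).sub (gX.mul_right H)) (GoodM.const _),
        expM_sub (gXX.sub (gX.mul_left H)) (gX.mul_right H),
        expM_sub gXX (gX.mul_left H), expM_mul_left H gX, expM_mul_right H gX, expM_const, ← hH]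
      abel
    have gg : GoodM μ (fun ω => (X ω - H) * 1 * (X ω - H)) := by
      have : (fun ω => (X ω - H) * 1 * (X ω - H))
          = fun ω => X ω * X ω - H * X ω - X ω * H + H * H := by
        ext1 ω; noncomm_ring
      rw [this]
      exact ((gXX.sub (gX.mul_left H)).sub (gX.mul_right H)).add (GoodM.const _)
    rw [e]
    exact expM_psd gg fun ω => psd_conj Matrix.PosSemidef.one ((pX ω).1.sub pH.1)
  have hHR : ((R ^ 2) • H - H * H).PosSemidef := by
    have := hRH.add hHS
    rwa [sub_add_sub_cancel] at this
  set A := 1 - η • H with hA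
  have hAh : A.IsHermitian := by
    rw [hA]; exact Matrix.isHermitian_one.sub (by
      have := (pH.smul hη0.le).1
      exact this)
  have pA : A.PosSemidef := by
    have e : A = A * 1 * A + ((η * (1 - η * R ^ 2)) • H + (η ^ 2) • ((R ^ 2) • H - H * H)) := by
      rw [hA]
      simp only [mul_sub, sub_mul, mul_one, one_mul, smul_mul_assoc, mul_smul_comm, smul_smul,
        smul_sub]
      module
    rw [e]
    exact (psd_conj Matrix.PosSemidef.one hAh).add
      ((pH.smul (mul_pos hη0 hηR).le).add (hHR.smul (sq_nonneg η)))
  have pP : ∀ t : ℕ, (A ^ t).PosSemidef := fun t => pA.pow t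
  have hHA : ∀ t : ℕ, Commute (η • H) (A ^ t) := fun t =>
    Commute.pow_right (by rw [hA]; exact (Commute.one_right _).sub_right (Commute.refl _)) t
  have pHP : ∀ t : ℕ, ((η • H) * (1 - A ^ t)).PosSemidef := by
    intro t
    have e : (η • H) * (1 - A ^ t) = ∑ s ∈ Finset.range t, (η • H) * A ^ s * (η • H) := by
      have h1 : (η • H) * ∑ s ∈ Finset.range t, A ^ s = 1 - A ^ t := by
        have := mul_neg_geom_sum A t
        rwa [show 1 - A = η • H by rw [hA]; abel] at this
      rw [← h1, Finset.mul_sum, Finset.mul_sum]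
      refine Finset.sum_congr rfl fun s _ => ?_
      rw [mul_assoc, (hHA s).eq]
    rw [e]
    exact Matrix.posSemidef_sum _ fun s _ => psd_conj (pP s) (pH.smul hη0.le).1
  -- expansion of the operator
  have hexp : ∀ M : Matrix (Fin d) (Fin d) ℝ,
      (fun ω => (1 - η • X ω) * M * (1 - η • X ω))
        = fun ω => M - η • (X ω * M) - η • (M * X ω) + (η ^ 2) • (X ω * M * X ω) := by
    intro M; ext1 ω
    simp only [mul_sub, sub_mul, mul_one, one_mul, smul_mul_assoc, mul_smul_comm, sq]
    module
  have gT : ∀ M, GoodM μ (fun ω => (1 - η • X ω) * M * (1 - η • X ω)) := by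
    intro M; rw [hexp]
    exact (((GoodM.const M).sub ((gX.mul_right M).smul η)).sub ((gX.mul_left M).smul η)).add
      ((gXMX M).smul _)
  have hT : ∀ M, expMatrix μ (fun ω => (1 - η • X ω) * M * (1 - η • X ω))
      = M - η • (H * M) - η • (M * H) + (η ^ 2) • expMatrix μ (fun ω => X ω * M * X ω) := by
    intro M
    rw [hexp, expM_add (((GoodM.const M).sub ((gX.mul_right M).smul η)).sub
      ((gX.mul_left M).smul η)) ((gXMX M).smul _),
      expM_sub ((GoodM.const M).sub ((gX.mul_right M).smul η)) ((gX.mul_left M).smul η),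
      expM_sub (GoodM.const M) ((gX.mul_right M).smul η), expM_smul, expM_smul, expM_smul,
      expM_const, expM_mul_left _ gX, expM_mul_right _ gX, ← hH]
  set c := η * σ ^ 2 / (1 - η * R ^ 2) with hc
  have hc0 : 0 ≤ c := by positivity
  have hcσ : η ^ 2 * σ ^ 2 = η * c * (1 - η * R ^ 2) := by
    rw [hc]; field_simp
  have main : ∀ t ≤ N, (c • (1 - A ^ t) - C t).PosSemidef := by
    intro t
    induction t with
    | zero => intro _; simpa [hC0] using Matrix.PosSemidef.zero
    | succ t ih =>
      intro ht
      have ih := ih (by omega)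
      have hrec : C (t + 1) = expMatrix μ (fun ω => (1 - η • X ω) * C t * (1 - η • X ω))
        + (η ^ 2 * σ ^ 2) • H := hCrec t (by omega)
      set D := c • (1 - A ^ t) with hD
      have pT : (expMatrix μ (fun ω => (1 - η • X ω) * (D - C t) * (1 - η • X ω))).PosSemidef :=
        expM_psd (gT _) fun ω => psd_conj ih
          (Matrix.isHermitian_one.sub ((pX ω).smul hη0.le).1)
      have eT : expMatrix μ (fun ω => (1 - η • X ω) * (D - C t) * (1 - η • X ω))
          = expMatrix μ (fun ω => (1 - η • X ω) * D * (1 - η • X ω))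
            - expMatrix μ (fun ω => (1 - η • X ω) * C t * (1 - η • X ω)) := by
        rw [← expM_sub (gT _) (gT _)]
        congr 1; ext1 ω
        rw [← sub_mul, ← mul_sub]
      have pQ : (expMatrix μ (fun ω => X ω * A ^ t * X ω)).PosSemidef :=
        expM_psd (gXMX _) fun ω => psd_conj (pP t) (pX ω).1
      have eQ : expMatrix μ (fun ω => X ω * D * X ω)
          = c • (S - expMatrix μ (fun ω => X ω * A ^ t * X ω)) := by
        rw [hS, ← expM_sub gXX (gXMX _), ← expM_smul]
        congr 1; ext1 ω
        rw [hD]; simp only [mul_sub, sub_mul, mul_one, smul_mul_assoc, mul_smul_comm]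
      set Q := expMatrix μ (fun ω => X ω * A ^ t * X ω)
      have hcomm : A ^ t * H = H * A ^ t := by
        have h := (hHA t).eq
        rw [smul_mul_assoc, mul_smul_comm] at h
        exact (smul_right_injective _ hη0.ne' h).symm
      have e : c • (1 - A ^ (t + 1)) - C (t + 1)
          = c • ((η • H) * (1 - A ^ t)) + (η ^ 2 * c) • ((R ^ 2) • H - S) + (η ^ 2 * c) • Q
            + expMatrix μ (fun ω => (1 - η • X ω) * (D - C t) * (1 - η • X ω)) := by
        rw [eT, hrec, hT D, eQ, hcσ, hD, pow_succ,
          show A ^ t * A = A ^ t - η • (H * A ^ t) by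
            conv_lhs => rw [hA]
            rw [← hA, mul_sub, mul_one, mul_smul_comm, hcomm]]
        simp only [mul_sub, sub_mul, mul_one, one_mul, smul_mul_assoc, mul_smul_comm, smul_smul,
          smul_sub, hcomm]
        module
      rw [e]
      have h0 : 0 ≤ η ^ 2 * c := by positivity
      exact ((((pHP t).smul hc0).add (hRH.smul h0)).add (pQ.smul h0)).add pT
  exact main N le_rfl
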